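/- Let A be a finite-dimensional algebra over a field k. Then dim D^b(mod A) ≤ repdim A, where repdim A is the representation dimension of A. -/

import Mathlib

/-!
Dimension of triangulated categories (Rouquier): the bounded derived category of
finitely generated modules over a finitely generated commutative algebra over a
perfect field has finite dimension.
-/

open CategoryTheory CategoryTheory.Limits CategoryTheory.Pretriangulated

section TriangulatedDimension

variable (C : Type*) [Category C] [HasZeroObject C] [Preadditive C] [HasShift C ℤ]
  [∀ n : ℤ, (shiftFunctor C n).Additive] [Pretriangulated C]

/-- `X` is a direct summand (retract) of `Z`. -/
def IsRetract (X Z : C) : Prop := ∃ (s : X ⟶ Z) (r : Z ⟶ X), s ≫ r = 𝟙 X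

/-- `I₁ * I₂` : the smallest class of objects, closed under direct summands, containing
every object `Z` fitting in a distinguished triangle `X₁ → Z → X₂ → X₁[1]` with
`X₁ ∈ I₁` and `X₂ ∈ I₂`. -/
def starSets (I₁ I₂ : Set C) : Set C :=
  {X | ∃ (X₁ Z X₂ : C) (f : X₁ ⟶ Z) (g : Z ⟶ X₂) (h : X₂ ⟶ X₁⟦(1 : ℤ)⟧),
    Triangle.mk f g h ∈ (distTriang C) ∧ X₁ ∈ I₁ ∧ X₂ ∈ I₂ ∧ IsRetract C X Z}

/-- `⟨M⟩` : the smallest class of objects of `C` containing `M` and closed under finite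
direct sums, direct summands and shifts in both directions. -/
inductive gen (M : C) : C → Prop
  | base : gen M M
  | sum {X Y Z : C} (i : X ⟶ Z) (p : Z ⟶ X) (j : Y ⟶ Z) (q : Z ⟶ Y) :
      gen M X → gen M Y → i ≫ p = 𝟙 X → j ≫ q = 𝟙 Y → i ≫ q = 0 → j ≫ p = 0 →
      p ≫ i + q ≫ j = 𝟙 Z → gen M Z
  | shift {X : C} (n : ℤ) : gen M X → gen M (X⟦n⟧)
  | retract {X Z : C} : gen M Z → IsRetract C X Z → gen M X

/-- The classes `⟨M⟩ᵢ` : `⟨M⟩₀ = {0}` and `⟨M⟩ᵢ₊₁ = ⟨M⟩ᵢ * ⟨M⟩`. -/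
def level (M : C) : ℕ → Set C
  | 0 => {X | IsZero X}
  | i + 1 => starSets C (level M i) {X | gen C M X}

/-- `dimLE S d` : the (triangulated) subcategory with class of objects `S` has dimension
at most `d`, i.e. there is an object `M` of `S` with `⟨M⟩_{d+1} = S`. -/
def dimLE (S : Set C) (d : ℕ) : Prop := ∃ M ∈ S, level C M (d + 1) = S

/-- The dimension of the (triangulated) subcategory with class of objects `S`, as an
element of `ℕ∞` : the least `d` such that some object generates `S` in `d + 1` steps,
and `∞` if there is no such `d`. -/
noncomputable def trdim (S : Set C) : ℕ∞ := sInf ((↑) '' {d : ℕ | dimLE C S d})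

end TriangulatedDimension

variable (A : Type) [Ring A]

noncomputable instance moduleCatHasDerivedCategory :
    HasDerivedCategory (ModuleCat.{0} A) :=
  HasDerivedCategory.standard _

/-- The class of objects of the bounded derived category `D^b(mod A)` of finitely
generated `A`-modules, realized inside the derived category of `A`-modules as the
complexes with bounded, finitely generated homology. -/
def Db : Set (DerivedCategory (ModuleCat.{0} A)) :=
  {X | (∃ a b : ℤ, ∀ n : ℤ, n < a ∨ b < n →
      IsZero ((DerivedCategory.homologyFunctor (ModuleCat.{0} A) n).obj X)) ∧
    ∀ n : ℤ, Module.Finite A ((DerivedCategory.homologyFunctor (ModuleCat.{0} A) n).obj X)}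

section ProjDim

/-- `pdLE B d M` says that the left `B`-module `M` has projective dimension at most `d`,
i.e. there is a projective resolution `0 → P_d → ⋯ → P_0 → M → 0`. -/
def pdLE (B : Type) [Ring B] : ℕ → (M : Type) → [AddCommGroup M] → [Module B M] → Prop
  | 0, M, _, _ => Module.Projective B M
  | d + 1, M, _, _ => ∃ (P : Type) (_ : AddCommGroup P) (_ : Module B P)
      (f : P →ₗ[B] M), Function.Surjective f ∧ Module.Projective B P ∧
        pdLE B d (LinearMap.ker f)

/-- `gldimLE B d` says that the global dimension of `B` is at most `d` : every
`B`-module has projective dimension at most `d`. -/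
def gldimLE (B : Type) [Ring B] (d : ℕ) : Prop :=
  ∀ (M : Type) (_ : AddCommGroup M) (_ : Module B M), pdLE B d M

/-- The global dimension of a ring `B`, as an element of `ℕ∞`:
the supremum of the projective dimensions of all `B`-modules. -/
noncomputable def gldim (B : Type) [Ring B] : ℕ∞ :=
  sInf ((↑) '' {d : ℕ | gldimLE B d})

end ProjDim

section RepDim

variable (k : Type) [Field k] (B : Type) [Ring B] [Algebra k B]

/-- The `k`-linear dual `B* = Hom_k(B, k)` of a `k`-algebra `B`, as a left `B`-module via
`(a • f) x = f (x * a)`. -/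
instance dualSMul : SMul B (B →ₗ[k] k) :=
  ⟨fun a f => f ∘ₗ LinearMap.mulRight k a⟩

theorem dualSMul_apply (a : B) (f : B →ₗ[k] k) (x : B) : (a • f) x = f (x * a) := rfl

instance dualModule : Module B (B →ₗ[k] k) where
  one_smul f := by ext x; simp [dualSMul_apply]
  mul_smul a b f := by ext x; simp [dualSMul_apply, mul_assoc]
  smul_zero a := by ext x; simp [dualSMul_apply]
  smul_add a f g := by ext x; simp [dualSMul_apply]
  add_smul a b f := by ext x; simp [dualSMul_apply, mul_add]
  zero_smul f := by ext x; simp [dualSMul_apply]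

/-- The representation dimension of a finite dimensional `k`-algebra `B` (Auslander):
the infimum over all finitely generated `B`-modules `M` of the global dimension of
`End_B(B ⊕ B* ⊕ M)`. -/
noncomputable def repdim : ℕ∞ :=
  sInf {x : ℕ∞ | ∃ (M : Type) (_ : AddCommGroup M) (_ : Module B M),
    Module.Finite B M ∧ gldim (Module.End B (B × (B →ₗ[k] k) × M)) = x}

end RepDim

section HomDual

open Module

variable {A : Type} [Ring A] {N : Type} [AddCommGroup N] [Module A N]

theorem hasProjectiveDimensionLT_of_pdLE {B : Type} [Ring B] (d : ℕ) :
    ∀ (M : Type) [AddCommGroup M] [Module B M], pdLE B d M →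
      HasProjectiveDimensionLT (ModuleCat.of B M) (d + 1) := by
  induction d with
  | zero =>
    intro M _ _ h
    have : Module.Projective B M := h
    have : Projective (ModuleCat.of B M) := (IsProjective.iff_projective _).1 inferInstance
    infer_instance
  | succ d ih =>
    rintro M _ _ ⟨P, _, _, f, hf, hP, hK⟩
    have : Projective (ModuleCat.of B P) := (IsProjective.iff_projective _).1 inferInstance
    have hP' : HasProjectiveDimensionLT (ModuleCat.of B P) (d + 1 + 1) :=
      hasProjectiveDimensionLT_of_ge _ 1 _ (by lia)
    exact (LinearMap.shortExact_shortComplexKer hf).hasProjectiveDimensionLT_X₃ _ (ih _ hK) hP'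

/-- Over a Noetherian ring, a finitely generated module of projective dimension `< n + 1` is a
quotient of a finitely generated projective module by a module of projective dimension `< n`. -/
theorem exists_projective_cover_step {B : Type} [Ring B] (H : Type)
    [AddCommGroup H] [Module B H] [Module.Finite B H] (n : ℕ)
    (hH : HasProjectiveDimensionLT (ModuleCat.of B H) (n + 1)) :
    ∃ (P : Type) (_ : AddCommGroup P) (_ : Module B P) (π : P →ₗ[B] H),
      Module.Finite B P ∧ Module.Projective B P ∧ Function.Surjective π ∧
      HasProjectiveDimensionLT (ModuleCat.of B (LinearMap.ker π)) n ∧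
      (Subsingleton H → Subsingleton P) := by
  by_cases hp : Module.Projective B H
  · refine ⟨H, _, _, LinearMap.id, inferInstance, hp, Function.surjective_id, ?_, id⟩
    have : IsZero (ModuleCat.of B (LinearMap.ker (LinearMap.id : H →ₗ[B] H))) := by
      rw [LinearMap.ker_id]
      exact ModuleCat.isZero_of_subsingleton _
    have := this.hasProjectiveDimensionLT_zero
    exact hasProjectiveDimensionLT_of_ge _ 0 _ (by lia)
  · obtain ⟨m, f, hf⟩ := Module.Finite.exists_fin' B H
    refine ⟨Fin m → B, _, _, f, inferInstance, inferInstance, hf, ?_, fun h => ?_⟩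
    · have : Projective (ModuleCat.of B (Fin m → B)) :=
        (IsProjective.iff_projective _).1 inferInstance
      obtain _ | n := n
      · have := projective_iff_hasProjectiveDimensionLT_one.2 hH
        exact (hp ((IsProjective.iff_projective H).2 this)).elim
      · exact (LinearMap.shortExact_shortComplexKer hf).hasProjectiveDimensionLT_X₁ _
          (hasProjectiveDimensionLT_of_ge _ 1 _ (by lia)) hH
    · exact (hp inferInstance).elim

/-- A finitely generated projective module has a finite dual basis. -/
theorem exists_finite_dual_basis {B : Type} [Ring B] (P : Type) [AddCommGroup P] [Module B P]
    [Module.Finite B P] [Module.Projective B P] :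
    ∃ (m : ℕ) (e : Fin m → P) (c : Fin m → P →ₗ[B] B), ∀ p, ∑ i, c i p • e i = p := by
  obtain ⟨m, f, hf⟩ := Module.Finite.exists_fin' B P
  obtain ⟨s, hs⟩ := Module.projective_lifting_property f LinearMap.id hf
  refine ⟨m, fun i => f (Pi.single i 1), fun i => LinearMap.proj i ∘ₗ s, fun p => ?_⟩
  conv_rhs => rw [← LinearMap.id_apply (R := B) p, ← hs, LinearMap.comp_apply,
    ← Finset.univ_sum_single (s p), map_sum]
  refine Finset.sum_congr rfl fun i _ => ?_
  rw [LinearMap.comp_apply, LinearMap.proj_apply, ← map_smul, ← Pi.single_smul, smul_eq_mul,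
    mul_one]

section

variable {P : Type} [AddCommGroup P] [Module (End A N) P]

/-- Evaluation `P → Hom_A(Hom_B(P, N), N)`, where `B = End_A(N)`. -/
def evalDual : P →ₗ[End A N] ((P →ₗ[End A N] N) →ₗ[A] N) where
  toFun p := { toFun := fun h => h p, map_add' := fun _ _ => rfl, map_smul' := fun _ _ => rfl }
  map_add' p q := by ext h; simp
  map_smul' b p := by ext h; simp

@[simp]
theorem evalDual_apply (p : P) (h : P →ₗ[End A N] N) : evalDual p h = h p := rfl

theorem evalDual_bijective [Module.Finite (End A N) P] [Module.Projective (End A N) P] :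
    Function.Bijective (evalDual : P →ₗ[End A N] ((P →ₗ[End A N] N) →ₗ[A] N)) := by
  obtain ⟨m, e, c, hc⟩ := exists_finite_dual_basis (B := End A N) P
  constructor
  · rw [← LinearMap.ker_eq_bot, LinearMap.ker_eq_bot']
    intro p hp
    have h0 : ∀ i, c i p = 0 := fun i => by
      ext n
      exact LinearMap.congr_fun hp (LinearMap.toSpanSingleton (End A N) N n ∘ₗ c i)
    rw [← hc p]
    simp [h0]
  · intro θ
    let t (i : Fin m) : N →ₗ[A] (P →ₗ[End A N] N) :=
      { toFun := fun n => LinearMap.toSpanSingleton (End A N) N n ∘ₗ c i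
        map_add' := fun x y => by ext q; simp
        map_smul' := fun a x => by ext q; simp }
    refine ⟨∑ i, (show End A N from θ ∘ₗ t i) • e i, ?_⟩
    ext h
    have hh : h = ∑ i, t i (h (e i)) := by
      ext q
      conv_lhs => rw [← hc q]
      simp [t]
    conv_rhs => rw [hh]
    simp

/-- For a finitely generated projective `P`, the identity of `Hom_B(P, N)` is a sum of maps
factoring through `N`. -/
theorem exists_sum_factor_dual [Module.Finite (End A N) P] [Module.Projective (End A N) P] :
    ∃ (m : ℕ) (r : Fin m → (P →ₗ[End A N] N) →ₗ[A] N) (t : Fin m → N →ₗ[A] (P →ₗ[End A N] N)),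
      ∑ i, t i ∘ₗ r i = LinearMap.id := by
  obtain ⟨m, e, c, hc⟩ := exists_finite_dual_basis (B := End A N) P
  refine ⟨m, fun i => evalDual (e i), fun i =>
      { toFun := fun n => LinearMap.toSpanSingleton (End A N) N n ∘ₗ c i
        map_add' := fun x y => by ext q; simp
        map_smul' := fun a x => by ext q; simp }, ?_⟩
  ext h q
  conv_rhs => rw [LinearMap.id_apply, ← hc q]
  simp

/-- The map `X → Hom_B(P, N)` corresponding to `g : P → Hom_A(X, N)`. -/
def adjDual {X : Type} [AddCommGroup X] [Module A X] (g : P →ₗ[End A N] (X →ₗ[A] N)) :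
    X →ₗ[A] (P →ₗ[End A N] N) where
  toFun x := { toFun := fun p => g p x
               map_add' := fun p q => by simp
               map_smul' := fun b p => by simp }
  map_add' x y := by ext p; simp
  map_smul' a x := by ext p; simp

@[simp]
theorem adjDual_apply {X : Type} [AddCommGroup X] [Module A X]
    (g : P →ₗ[End A N] (X →ₗ[A] N)) (x : X) (p : P) : adjDual g x p = g p x := rfl

end

end HomDual

section DualCohomology

open Module

variable {A : Type} [Ring A] (N : Type) [AddCommGroup N] [Module A N]

/-- Precomposition with a linear map, as a map of `End_A(N)`-modules. -/
def precompDual {X Y : Type} [AddCommGroup X] [Module A X] [AddCommGroup Y] [Module A Y]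
    (f : X →ₗ[A] Y) : (Y →ₗ[A] N) →ₗ[End A N] (X →ₗ[A] N) where
  toFun h := h ∘ₗ f
  map_add' _ _ := rfl
  map_smul' _ _ := rfl

variable (X : CochainComplex (ModuleCat.{0} A) ℤ)

/-- The cocycles of the complex `Hom_A(X, N)` in the spot of `X.X i`. -/
def dualCycles (i : ℤ) : Submodule (End A N) (X.X i →ₗ[A] N) :=
  LinearMap.ker (precompDual N (X.d (i - 1) i).hom)

/-- The coboundaries of the complex `Hom_A(X, N)` in the spot of `X.X i`. -/
def dualBoundaries (i : ℤ) : Submodule (End A N) (X.X i →ₗ[A] N) :=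
  LinearMap.range (precompDual N (X.d i (i + 1)).hom)

/-- The cohomology of the complex `Hom_A(X, N)` in the spot of `X.X i`. -/
abbrev dualCohomology (i : ℤ) : Type :=
  dualCycles N X i ⧸ (dualBoundaries N X i).submoduleOf (dualCycles N X i)

variable {N X}

theorem mem_dualCycles {i j : ℤ} (h : i + 1 = j) {f : X.X j →ₗ[A] N} :
    f ∈ dualCycles N X j ↔ ∀ x, f (X.d i j x) = 0 := by
  obtain rfl : i = j - 1 := by lia
  exact LinearMap.ext_iff

theorem mem_dualBoundaries {i j : ℤ} (h : i + 1 = j) {f : X.X i →ₗ[A] N} :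
    f ∈ dualBoundaries N X i ↔ ∃ g : X.X j →ₗ[A] N, ∀ x, g (X.d i j x) = f x := by
  subst h
  refine exists_congr fun g => LinearMap.ext_iff

theorem exists_dual_resolution_step [IsNoetherianRing (End A N)] (n : ℕ) (i : ℤ)
    [Module.Finite (End A N) (X.X i →ₗ[A] N)]
    (hH : HasProjectiveDimensionLT (ModuleCat.of (End A N) (dualCohomology N X i)) (n + 1)) :
    ∃ (P : Type) (_ : AddCommGroup P) (_ : Module (End A N) P)
      (g : P →ₗ[End A N] (X.X i →ₗ[A] N)),
      Module.Finite (End A N) P ∧ Module.Projective (End A N) P ∧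
      (∀ p, g p ∈ dualCycles N X i) ∧
      (∀ f ∈ dualCycles N X i, ∃ p, f - g p ∈ dualBoundaries N X i) ∧
      HasProjectiveDimensionLT
        (ModuleCat.of (End A N) ((dualBoundaries N X i).comap g)) n ∧
      (Subsingleton (X.X i) → Subsingleton P) := by
  have : IsNoetherian (End A N) (X.X i →ₗ[A] N) := isNoetherian_of_isNoetherianRing_of_finite _ _
  obtain ⟨P, _, _, π, h1, h2, h3, h4, h5⟩ := exists_projective_cover_step
    (dualCohomology N X i) n hH
  obtain ⟨s, hs⟩ := Module.projective_lifting_property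
    ((dualBoundaries N X i).submoduleOf (dualCycles N X i)).mkQ π (Submodule.mkQ_surjective _)
  have hs' : ∀ p, Submodule.Quotient.mk (s p) = π p := fun p => LinearMap.congr_fun hs p
  have key : LinearMap.ker π = (dualBoundaries N X i).comap
      ((dualCycles N X i).subtype ∘ₗ s) := by
    ext p
    rw [LinearMap.mem_ker, ← hs' p, Submodule.Quotient.mk_eq_zero]
    rfl
  refine ⟨P, _, _, (dualCycles N X i).subtype ∘ₗ s, h1, h2, fun p => (s p).2, fun f hf => ?_,
    key ▸ h4, fun h => h5 ?_⟩
  · obtain ⟨p, hp⟩ := h3 (Submodule.Quotient.mk ⟨f, hf⟩)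
    refine ⟨p, ?_⟩
    rw [← hs' p, eq_comm, Submodule.Quotient.eq] at hp
    exact hp
  · have : Subsingleton (X.X i →ₗ[A] N) := ⟨fun f g => by
      ext x
      rw [Subsingleton.elim x 0, map_zero, map_zero]⟩
    infer_instance

/-- Data of maps from `X` to a complex `W` with zero differential. -/
structure AttachData (X : CochainComplex (ModuleCat.{0} A) ℤ) (W : ℤ → ModuleCat.{0} A) where
  /-- the components -/
  φ : ∀ i j : ℤ, X.X i ⟶ W j
  shape : ∀ i j : ℤ, i + 1 ≠ j → φ i j = 0
  d_comp : ∀ i j k : ℤ, X.d i j ≫ φ j k = 0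

namespace AttachData

variable {W : ℤ → ModuleCat.{0} A} (D : AttachData X W)

/-- The complex with components `X.X i × W i` and differential `(x, w) ↦ (d x, φ x)`. -/
def complex : CochainComplex (ModuleCat.{0} A) ℤ where
  X i := ModuleCat.of A (X.X i × W i)
  d i j := ModuleCat.ofHom (((X.d i j).hom.prod (D.φ i j).hom) ∘ₗ LinearMap.fst A _ _)
  shape i j h := by
    have h' : ¬ i + 1 = j := h
    ext1
    simp only [X.shape i j h, D.shape i j h']
    ext <;> simp
  d_comp_d' i j k _ _ := by
    ext1
    refine LinearMap.ext fun x => Prod.ext ?_ ?_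
    · exact congr($(X.d_comp_d i j k) x.1)
    · exact congr($(D.d_comp i j k) x.1)

variable (W) in
/-- The complex with components `W i` and zero differential. -/
@[simps]
def zeroComplex : CochainComplex (ModuleCat.{0} A) ℤ where
  X := W
  d _ _ := 0

/-- The inclusion of `W`. -/
def ι : zeroComplex W ⟶ D.complex where
  f i := ModuleCat.ofHom (LinearMap.inr A _ _)
  comm' i j _ := by
    ext1
    refine LinearMap.ext fun x => Prod.ext ?_ ?_
    · exact map_zero (X.d i j).hom
    · exact map_zero (D.φ i j).hom

/-- The projection to `X`. -/
def π : D.complex ⟶ X where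
  f _ := ModuleCat.ofHom (LinearMap.fst A _ _)
  comm' _ _ _ := rfl

/-- The short exact sequence `W → D.complex → X`. -/
@[simps]
def shortComplex : ShortComplex (CochainComplex (ModuleCat.{0} A) ℤ) where
  X₁ := zeroComplex W
  X₂ := D.complex
  X₃ := X
  f := D.ι
  g := D.π
  zero := by
    ext i : 2
    rfl

theorem shortExact : D.shortComplex.ShortExact := by
  apply HomologicalComplex.shortExact_of_degreewise_shortExact
  intro i
  apply ModuleCat.shortComplex_shortExact
  · rintro ⟨x, w⟩
    constructor
    · rintro rfl
      exact ⟨w, rfl⟩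
    · rintro ⟨w, h⟩
      exact (congr_arg Prod.fst h).symm
  · exact fun w w' h => congr_arg Prod.snd h
  · exact fun x => ⟨(x, 0), rfl⟩

end AttachData

/-- `Hom_A(-, N)`-cohomology drops to the kernels after attaching the duals of projective
modules. -/
theorem exists_attach [IsNoetherianRing (End A N)]
    (hfin : ∀ i, Module.Finite (End A N) (X.X i →ₗ[A] N)) (n : ℕ)
    (hH : ∀ i, HasProjectiveDimensionLT
      (ModuleCat.of (End A N) (dualCohomology N X i)) (n + 1)) :
    ∃ (P : ℤ → Type) (_ : ∀ i, AddCommGroup (P i)) (_ : ∀ i, Module (End A N) (P i))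
      (D : AttachData X (fun i => ModuleCat.of A (P i →ₗ[End A N] N))),
      (∀ i, Module.Finite (End A N) (P i)) ∧ (∀ i, Module.Projective (End A N) (P i)) ∧
      (∀ i j, i + 1 = j → Subsingleton (X.X i) → Subsingleton (P j)) ∧
      ∀ i, HasProjectiveDimensionLT
        (ModuleCat.of (End A N) (dualCohomology N D.complex i)) n := by
  choose P' i1 i2 g' h1 h2 h3 h4 h5 h6 using fun i => exists_dual_resolution_step n i (hH i)
  let P (j : ℤ) : Type := P' (j - 1)
  let (j : ℤ) : AddCommGroup (P j) := i1 (j - 1)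
  let (j : ℤ) : Module (End A N) (P j) := i2 (j - 1)
  obtain ⟨g, hg0, hg⟩ : ∃ g : ∀ i j, P j →ₗ[End A N] (X.X i →ₗ[A] N),
      (∀ i j, i + 1 ≠ j → g i j = 0) ∧ ∀ j, g (j - 1) j = g' (j - 1) := by
    refine ⟨fun i j => if h : j - 1 = i then h ▸ g' (j - 1) else 0, fun i j h => ?_, fun j => ?_⟩
    · exact dif_neg (by lia)
    · exact dif_pos rfl
  have hgc : ∀ i j p, g i j p ∈ dualCycles N X i := by
    intro i j p
    by_cases h : i + 1 = j
    · obtain rfl : i = j - 1 := by lia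
      rw [hg]
      exact h3 _ p
    · rw [hg0 i j h]
      exact zero_mem _
  have h4' : ∀ i j, i + 1 = j → ∀ f ∈ dualCycles N X i,
      ∃ p, f - g i j p ∈ dualBoundaries N X i := by
    intro i j h f hf
    obtain rfl : i = j - 1 := by lia
    rw [hg]
    exact h4 _ f hf
  let D : AttachData X (fun i => ModuleCat.of A (P i →ₗ[End A N] N)) :=
    { φ := fun i j => ModuleCat.ofHom (adjDual (g i j))
      shape := fun i j h => by
        rw [hg0 i j h]
        rfl
      d_comp := fun i j k => by
        ext x : 2
        refine LinearMap.ext fun p => ?_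
        change g j k p (X.d i j x) = 0
        by_cases h : i + 1 = j
        · exact (mem_dualCycles h).1 (hgc j k p) x
        · rw [X.shape i j h]
          exact map_zero _ }
  refine ⟨P, inferInstance, inferInstance, D, fun i => h1 _, fun i => h2 _, ?_, fun i => ?_⟩
  · rintro i j h hX
    obtain rfl : i = j - 1 := by lia
    exact h6 _ hX
  have := h1 (i - 1)
  have := h2 (i - 1)
  let e : P i ≃ₗ[End A N] ((P i →ₗ[End A N] N) →ₗ[A] N) := LinearEquiv.ofBijective evalDual
    (evalDual_bijective (P := P' (i - 1)))
  have he : ∀ (β : (P i →ₗ[End A N] N) →ₗ[A] N) (h : P i →ₗ[End A N] N), h (e.symm β) = β h :=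
    fun β h => LinearMap.congr_fun (e.apply_symm_apply β) h
  let inl (i : ℤ) : X.X i →ₗ[A] D.complex.X i := LinearMap.inl A (X.X i) (P i →ₗ[End A N] N)
  let inr (i : ℤ) : (P i →ₗ[End A N] N) →ₗ[A] D.complex.X i :=
    LinearMap.inr A (X.X i) (P i →ₗ[End A N] N)
  have hd : ∀ (i j : ℤ) (x : D.complex.X i),
      D.complex.d i j x = inl j (X.d i j (D.π.f i x)) + inr j (adjDual (g i j) (D.π.f i x)) := by
    intro i j x
    refine Prod.ext ?_ ?_
    · exact (add_zero _).symm
    · exact (zero_add _).symm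
  have hsplit : ∀ (i : ℤ) (x : D.complex.X i), ∃ (y : X.X i) (w : P i →ₗ[End A N] N),
      x = inl i y + inr i w := by
    intro i x
    refine ⟨x.1, x.2, Prod.ext ?_ ?_⟩
    · exact (add_zero _).symm
    · exact (zero_add _).symm
  have hπl : ∀ (i : ℤ) (y : X.X i), D.π.f i (inl i y) = y := fun _ _ => rfl
  have hπr : ∀ (i : ℤ) (w : P i →ₗ[End A N] N), D.π.f i (inr i w) = 0 := fun _ _ => rfl
  have hZ : ∀ (f : D.complex.X i →ₗ[A] N), f ∈ dualCycles N D.complex i ↔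
      ∀ x : X.X (i - 1), f (inl i (X.d (i - 1) i x)) +
        g (i - 1) i (e.symm (f ∘ₗ inr i)) x = 0 := by
    intro f
    rw [mem_dualCycles (sub_add_cancel i 1)]
    have key : ∀ x, g (i - 1) i (e.symm (f ∘ₗ inr i)) x = f (inr i (adjDual (g (i - 1) i) x)) :=
      fun x => he (f ∘ₗ inr i) (adjDual (g (i - 1) i) x)
    constructor
    · intro h x
      have := h (inl _ x)
      rwa [hd, map_add, hπl, ← key] at this
    · intro h x
      rw [hd, map_add, ← key]
      exact h _
  let Ψ : dualCycles N D.complex i →ₗ[End A N] (dualBoundaries N X (i - 1)).comap (g (i - 1) i) :=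
    LinearMap.codRestrict _ (e.symm.toLinearMap ∘ₗ precompDual N (inr i) ∘ₗ Submodule.subtype _)
      (fun f => by
        refine (mem_dualBoundaries (sub_add_cancel i 1)).2 ⟨-(f.1 ∘ₗ inl i), fun x => ?_⟩
        rw [LinearMap.neg_apply, neg_eq_iff_add_eq_zero]
        exact (hZ f.1).1 f.2 x)
  have hΨ : Function.Surjective Ψ := by
    rintro ⟨p, hp⟩
    obtain ⟨α, hα⟩ := (mem_dualBoundaries (sub_add_cancel i 1)).1 hp
    let f : D.complex.X i →ₗ[A] N := (-α).coprod (e p)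
    have hf : f ∘ₗ inr i = e p := LinearMap.coprod_inr _ _
    have hf' : f ∘ₗ inl i = -α := LinearMap.coprod_inl _ _
    refine ⟨⟨f, (hZ f).2 fun x => ?_⟩, Subtype.ext ?_⟩
    · rw [hf, e.symm_apply_apply, ← hα, ← LinearMap.comp_apply, hf', LinearMap.neg_apply,
        neg_add_cancel]
    · change e.symm (f ∘ₗ inr i) = p
      rw [hf, e.symm_apply_apply]
  have hker : LinearMap.ker Ψ =
      (dualBoundaries N D.complex i).submoduleOf (dualCycles N D.complex i) := by
    ext ⟨f, hf⟩
    have h0 : ⟨f, hf⟩ ∈ LinearMap.ker Ψ ↔ f ∘ₗ inr i = 0 := by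
      rw [← e.symm.map_eq_zero_iff]
      exact Subtype.ext_iff
    rw [h0]
    change _ ↔ f ∈ dualBoundaries N D.complex i
    rw [mem_dualBoundaries rfl]
    constructor
    · intro h
      have hα : f ∘ₗ inl i ∈ dualCycles N X i := by
        rw [mem_dualCycles (sub_add_cancel i 1)]
        intro x
        have := (hZ f).1 hf x
        rwa [h, map_zero, map_zero, LinearMap.zero_apply, add_zero] at this
      obtain ⟨p, hp⟩ := h4' i (i + 1) rfl _ hα
      obtain ⟨a, ha⟩ := (mem_dualBoundaries rfl).1 hp
      let G : D.complex.X (i + 1) →ₗ[A] N := a.coprod (evalDual p)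
      have hGl : ∀ y, G (inl _ y) = a y := LinearMap.congr_fun (LinearMap.coprod_inl a (evalDual p))
      have hGr : ∀ w, G (inr _ w) = w p :=
        LinearMap.congr_fun (LinearMap.coprod_inr a (evalDual p))
      refine ⟨G, fun x => ?_⟩
      obtain ⟨y, w, rfl⟩ := hsplit i x
      have hw : f (inr i w) = 0 := LinearMap.congr_fun h w
      rw [hd, map_add, hGl, hGr, map_add, hπl, hπr, add_zero, ha, adjDual_apply, map_add, hw]
      simp
    · rintro ⟨G, hG⟩
      ext w
      change f (inr i w) = 0
      rw [← hG, hd, hπr]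
      simp
  have h5' := h5 (i - 1)
  rw [← hg i] at h5'
  exact hasProjectiveDimensionLT_of_iso ((Submodule.quotEquivOfEq _ _ hker).symm.trans
    (Ψ.quotKerEquivOfSurjective hΨ)).symm.toModuleIso n

end DualCohomology

section Gen

variable {C : Type*} [Category C]

theorem isRetract_of_iso {X Y : C} (e : X ≅ Y) : IsRetract C X Y :=
  ⟨e.hom, e.inv, e.hom_inv_id⟩

variable [Preadditive C] [HasShift C ℤ] {M : C}

variable (M) in
/-- `f` factors through an object of `⟨M⟩`. -/
def FactorsGen {X Y : C} (f : X ⟶ Y) : Prop :=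
  ∃ (Z : C) (a : X ⟶ Z) (b : Z ⟶ Y), gen C M Z ∧ a ≫ b = f

theorem FactorsGen.comp_left {X Y Z : C} {g : Y ⟶ Z} (hg : FactorsGen M g) (f : X ⟶ Y) :
    FactorsGen M (f ≫ g) := by
  obtain ⟨W, a, b, hW, rfl⟩ := hg
  exact ⟨W, f ≫ a, b, hW, by simp⟩

theorem FactorsGen.of_gen {X Y : C} (hX : gen C M X) (f : X ⟶ Y) : FactorsGen M f :=
  ⟨X, 𝟙 X, f, hX, Category.id_comp f⟩

theorem gen_of_factorsGen_id {X : C} (h : FactorsGen M (𝟙 X)) : gen C M X := by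
  obtain ⟨Z, a, b, hZ, h⟩ := h
  exact hZ.retract ⟨a, b, h⟩

variable [HasZeroObject C] [∀ n : ℤ, (shiftFunctor C n).Additive] [Pretriangulated C]

theorem gen_biprod {X Y : C} (hX : gen C M X) (hY : gen C M Y) : gen C M (X ⊞ Y) :=
  gen.sum biprod.inl biprod.fst biprod.inr biprod.snd hX hY (by simp) (by simp) (by simp)
    (by simp) (by simp)

theorem FactorsGen.sum {ι : Type*} (s : Finset ι) {X Y : C} (f : ι → (X ⟶ Y))
    (h : ∀ i ∈ s, FactorsGen M (f i)) : FactorsGen M (∑ i ∈ s, f i) := by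
  classical
  induction s using Finset.induction_on with
  | empty => exact ⟨M, 0, 0, gen.base, by simp⟩
  | insert i s hi ih =>
    obtain ⟨Z, a, b, hZ, h1⟩ := h i (Finset.mem_insert_self i s)
    obtain ⟨Z', a', b', hZ', h2⟩ := ih fun j hj => h j (Finset.mem_insert_of_mem hj)
    exact ⟨Z ⊞ Z', biprod.lift a a', biprod.desc b b', gen_biprod hZ hZ', by
      rw [biprod.lift_desc, h1, h2, Finset.sum_insert hi]⟩

theorem level_of_iso {n : ℕ} {X Y : C} (e : X ≅ Y) (hY : Y ∈ level C M n) : X ∈ level C M n := by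
  cases n with
  | zero => exact IsZero.of_iso hY e
  | succ n =>
    obtain ⟨X₁, Z, X₂, f, g, h, hT, h1, h2, s, r, hsr⟩ := hY
    exact ⟨X₁, Z, X₂, f, g, h, hT, h1, h2, e.hom ≫ s, r ≫ e.inv, by simp [reassoc_of% hsr]⟩

end Gen

section ZeroComplex

variable {A : Type} [Ring A] {N : Type} [AddCommGroup N] [Module A N]

open AttachData in
theorem id_zeroComplex_eq_sum (W : ℤ → ModuleCat.{0} A) (s : Finset ℤ)
    (hW : ∀ i ∉ s, Subsingleton (W i)) :
    ∃ (p : ∀ i, zeroComplex W ⟶ (HomologicalComplex.single _ (.up ℤ) i).obj (W i))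
      (q : ∀ i, (HomologicalComplex.single _ (.up ℤ) i).obj (W i) ⟶ zeroComplex W),
      𝟙 (zeroComplex W) = ∑ i ∈ s, p i ≫ q i := by
  let p (i : ℤ) : zeroComplex W ⟶ (HomologicalComplex.single _ (.up ℤ) i).obj (W i) :=
    HomologicalComplex.mkHomToSingle (K := zeroComplex W) (𝟙 _) (fun _ _ => zero_comp)
  let q (i : ℤ) : (HomologicalComplex.single _ (.up ℤ) i).obj (W i) ⟶ zeroComplex W :=
    HomologicalComplex.mkHomFromSingle (K := zeroComplex W) (𝟙 _) (fun _ _ => comp_zero)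
  refine ⟨p, q, ?_⟩
  ext j : 1
  change _ = (HomologicalComplex.eval _ _ j).map (∑ i ∈ s, p i ≫ q i)
  rw [Functor.map_sum]
  by_cases hj : j ∈ s
  · rw [Finset.sum_eq_single_of_mem j hj]
    · change _ = (p j).f j ≫ (q j).f j
      have hp : (p j).f j = _ := HomologicalComplex.mkHomToSingle_f _ _
      have hq : (q j).f j = _ := HomologicalComplex.mkHomFromSingle_f _ _
      rw [hp, hq]
      have {V : ModuleCat.{0} A} (e : V ≅ W j) :
          𝟙 (W j) = (𝟙 (W j) ≫ e.inv) ≫ e.hom ≫ 𝟙 (W j) := by simp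
      exact this _
    · intro i _ hij
      change (p i).f j ≫ (q i).f j = 0
      rw [(HomologicalComplex.isZero_single_obj_X (.up ℤ) i (W i) j hij.symm).eq_of_tgt
        ((p i).f j) 0, zero_comp]
  · have := hW j hj
    exact (ModuleCat.isZero_of_subsingleton (W j)).eq_of_src _ _

theorem gen_single_shift {X : ModuleCat.{0} A} {M : DerivedCategory (ModuleCat.{0} A)}
    (h : gen _ M ((DerivedCategory.singleFunctor _ 0).obj X)) (i : ℤ) :
    gen _ M ((DerivedCategory.singleFunctor _ i).obj X) :=
  (h.shift (-i)).retract (isRetract_of_iso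
    (((DerivedCategory.singleFunctors (ModuleCat.{0} A)).shiftIso (-i) i 0 (by lia)).app X).symm)

theorem gen_single_of_sum_factor (W : ModuleCat.{0} A) (i : ℤ)
    (hW : ∃ m, ∃ (r : Fin m → W →ₗ[A] N) (t : Fin m → N →ₗ[A] W),
      ∑ j, t j ∘ₗ r j = LinearMap.id) :
    gen _ ((DerivedCategory.singleFunctor _ 0).obj (ModuleCat.of A N))
      ((DerivedCategory.singleFunctor _ i).obj W) := by
  obtain ⟨m, r, t, h⟩ := hW
  apply gen_of_factorsGen_id
  have h' : 𝟙 W = ∑ j, ModuleCat.ofHom (r j) ≫ ModuleCat.ofHom (t j) := by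
    ext1
    rw [ModuleCat.hom_sum]
    exact h.symm
  rw [← CategoryTheory.Functor.map_id, h', Functor.map_sum]
  refine .sum _ _ fun j _ => ?_
  rw [Functor.map_comp]
  exact (FactorsGen.of_gen (gen_single_shift gen.base i) _).comp_left _

theorem gen_zeroComplex (W : ℤ → ModuleCat.{0} A) (s : Finset ℤ)
    (hs : ∀ i ∉ s, Subsingleton (W i))
    (hW : ∀ i, ∃ m, ∃ (r : Fin m → W i →ₗ[A] N) (t : Fin m → N →ₗ[A] W i),
      ∑ j, t j ∘ₗ r j = LinearMap.id) :
    gen _ ((DerivedCategory.singleFunctor _ 0).obj (ModuleCat.of A N))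
      (DerivedCategory.Q.obj (AttachData.zeroComplex W)) := by
  obtain ⟨p, q, h⟩ := id_zeroComplex_eq_sum W s hs
  apply gen_of_factorsGen_id
  rw [← CategoryTheory.Functor.map_id, h, Functor.map_sum]
  refine .sum _ _ fun i _ => ?_
  rw [Functor.map_comp]
  exact (FactorsGen.of_gen (gen_single_of_sum_factor (W i) i (hW i)) _).comp_left _

end ZeroComplex

section MainInduction

open Module ZeroObject

variable {A : Type} [Ring A]

theorem exactAt_iff_apply (X : CochainComplex (ModuleCat.{0} A) ℤ) {i j k : ℤ} (hij : i + 1 = j)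
    (hjk : j + 1 = k) : X.ExactAt j ↔ ∀ x, X.d j k x = 0 → ∃ y, X.d i j y = x := by
  rw [X.exactAt_iff' i j k (by simp; lia) (by simpa), ShortComplex.moduleCat_exact_iff]
  rfl

theorem isZero_Q_obj_of_acyclic {X : CochainComplex (ModuleCat.{0} A) ℤ} (hX : X.Acyclic) :
    IsZero (DerivedCategory.Q.obj X) := by
  have h : QuasiIso (0 : X ⟶ 0) :=
    ⟨fun i => (quasiIsoAt_iff_exactAt _ i (hX i)).2
      (HomologicalComplex.acyclic_of_isZero _ (isZero_zero _) i)⟩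
  have := (DerivedCategory.isIso_Q_map_iff_quasiIso _ _).2 h
  exact (DerivedCategory.Q.map_isZero (isZero_zero _)).of_iso
    (asIso (DerivedCategory.Q.map (0 : X ⟶ 0)))

variable (N : Type) [AddCommGroup N] [Module A N]

theorem finite_of_sum_factor [Module.Finite A N] (W : Type) [AddCommGroup W] [Module A W]
    (hW : ∃ m, ∃ (r : Fin m → W →ₗ[A] N) (t : Fin m → N →ₗ[A] W),
      ∑ j, t j ∘ₗ r j = LinearMap.id) : Module.Finite A W := by
  obtain ⟨m, r, t, h⟩ := hW
  refine Module.Finite.of_surjective (∑ j, t j ∘ₗ LinearMap.proj j : (Fin m → N) →ₗ[A] W)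
    fun w => ⟨fun j => r j w, ?_⟩
  simpa using LinearMap.congr_fun h w

/-- A bounded complex `X` of finitely generated modules is obtained in `n` steps from `N` if
the cohomology of `Hom_A(X, N)` has projective dimension less than `n`, provided that
`Hom_A(-, N)` detects acyclicity. -/
theorem mem_level_of_dualCohomology [IsNoetherianRing (End A N)] [Module.Finite A N]
    (hN : ∀ (X : Type) [AddCommGroup X] [Module A X] [Module.Finite A X],
      Module.Finite (End A N) (X →ₗ[A] N))
    (hcog : ∀ X : CochainComplex (ModuleCat.{0} A) ℤ,
      (∀ i, Subsingleton (dualCohomology N X i)) → X.Acyclic)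
    (n : ℕ) (X : CochainComplex (ModuleCat.{0} A) ℤ) (s : Finset ℤ)
    (hs : ∀ i ∉ s, Subsingleton (X.X i)) (hfin : ∀ i, Module.Finite A (X.X i))
    (hH : ∀ i, HasProjectiveDimensionLT (ModuleCat.of (End A N) (dualCohomology N X i)) n) :
    DerivedCategory.Q.obj X ∈
      level _ ((DerivedCategory.singleFunctor _ 0).obj (ModuleCat.of A N)) n := by
  induction n generalizing X s with
  | zero =>
    refine isZero_Q_obj_of_acyclic (hcog X fun i => ?_)
    have := hH i
    rw [hasProjectiveDimensionLT_zero_iff_isZero] at this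
    exact ModuleCat.subsingleton_of_isZero this
  | succ n ih =>
    obtain ⟨P, _, _, D, h1, h2, h3, h4⟩ := exists_attach (fun i => hN (X.X i)) n hH
    have hP := fun i => exists_sum_factor_dual (A := A) (N := N) (P := P i)
    have hP' : ∀ j, j ∉ s.image (· + 1) → Subsingleton (P j) := by
      intro j hj
      refine h3 (j - 1) j (by lia) (hs _ fun h => hj ?_)
      exact Finset.mem_image.2 ⟨j - 1, h, by lia⟩
    have hW : ∀ j, j ∉ s.image (· + 1) → Subsingleton (P j →ₗ[End A N] N) := by
      intro j hj
      have := hP' j hj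
      infer_instance
    have hD : DerivedCategory.Q.obj D.complex ∈
        level _ ((DerivedCategory.singleFunctor _ 0).obj (ModuleCat.of A N)) n := by
      refine ih D.complex (s ∪ s.image (· + 1)) (fun i hi => ?_) (fun i => ?_) h4
      · rw [Finset.mem_union, not_or] at hi
        have := hs i hi.1
        have := hW i hi.2
        change Subsingleton (X.X i × (P i →ₗ[End A N] N))
        infer_instance
      · have := hfin i
        have := finite_of_sum_factor N _ (hP i)
        change Module.Finite A (X.X i × (P i →ₗ[End A N] N))
        infer_instance
    exact ⟨_, _, _, _, _, _, rot_of_distTriang _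
      (DerivedCategory.triangleOfSES_distinguished D.shortExact), hD,
      (gen_zeroComplex _ (s.image (· + 1)) hW hP).shift 1, isRetract_of_iso (Iso.refl _)⟩

end MainInduction

section DbClosure

variable {A : Type} [Ring A]

theorem mem_Db_of_isRetract {X Z : DerivedCategory (ModuleCat.{0} A)}
    (h : IsRetract _ X Z) (hZ : Z ∈ Db A) : X ∈ Db A := by
  obtain ⟨s, r, hsr⟩ := h
  have key : ∀ n x, (DerivedCategory.homologyFunctor _ n).map r
      ((DerivedCategory.homologyFunctor _ n).map s x) = x := fun n x => by
    rw [← ModuleCat.comp_apply, ← Functor.map_comp, hsr, CategoryTheory.Functor.map_id]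
    rfl
  obtain ⟨⟨a, b, h1⟩, h2⟩ := hZ
  refine ⟨⟨a, b, fun n hn => ?_⟩, fun n => ?_⟩
  · have := ModuleCat.subsingleton_of_isZero (h1 n hn)
    have := Function.LeftInverse.injective (key n) |>.subsingleton
    exact ModuleCat.isZero_of_subsingleton _
  · have := h2 n
    exact Module.Finite.of_surjective ((DerivedCategory.homologyFunctor _ n).map r).hom
      (Function.LeftInverse.surjective (key n))

theorem mem_Db_of_exact [IsNoetherianRing A] {X Z Y : DerivedCategory (ModuleCat.{0} A)}
    (hX : X ∈ Db A) (hY : Y ∈ Db A)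
    (h : ∀ n, ∃ S : ShortComplex (ModuleCat.{0} A), S.Exact ∧
      S.X₁ = (DerivedCategory.homologyFunctor _ n).obj X ∧
      S.X₂ = (DerivedCategory.homologyFunctor _ n).obj Z ∧
      S.X₃ = (DerivedCategory.homologyFunctor _ n).obj Y) : Z ∈ Db A := by
  obtain ⟨⟨a, b, h1⟩, h2⟩ := hX
  obtain ⟨⟨a', b', h1'⟩, h2'⟩ := hY
  refine ⟨⟨min a a', max b b', fun n hn => ?_⟩, fun n => ?_⟩
  · obtain ⟨S, hS, e1, e2, e3⟩ := h n
    rw [← e2]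
    exact hS.isZero_of_both_zeros
      ((e1 ▸ h1 n (by lia) : IsZero S.X₁).eq_of_src _ _)
      ((e3 ▸ h1' n (by lia) : IsZero S.X₃).eq_of_tgt _ _)
  · obtain ⟨S, hS, e1, e2, e3⟩ := h n
    rw [← e2]
    have : Module.Finite A S.X₁ := e1 ▸ h2 n
    have : Module.Finite A S.X₃ := e3 ▸ h2' n
    have := isNoetherian_of_range_eq_ker S.f.hom S.g.hom hS.moduleCat_range_eq_ker
    infer_instance

theorem shift_mem_Db {X : DerivedCategory (ModuleCat.{0} A)} (hX : X ∈ Db A) (m : ℤ) :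
    X⟦m⟧ ∈ Db A := by
  obtain ⟨⟨a, b, h1⟩, h2⟩ := hX
  have e (n : ℤ) : (DerivedCategory.homologyFunctor _ n).obj (X⟦m⟧) ≅
      (DerivedCategory.homologyFunctor _ (m + n)).obj X :=
    ((DerivedCategory.homologyFunctor (ModuleCat.{0} A) 0).shiftIso m n (m + n) rfl).app X
  refine ⟨⟨a - m, b - m, fun n hn => (h1 _ (by lia)).of_iso (e n)⟩, fun n => ?_⟩
  have := h2 (m + n)
  exact Module.Finite.equiv (e n).toLinearEquiv.symm

theorem single_mem_Db (N : ModuleCat.{0} A) [Module.Finite A N] :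
    (DerivedCategory.singleFunctor _ 0).obj N ∈ Db A := by
  have h : ∀ n : ℤ, n < 0 ∨ 0 < n → IsZero ((DerivedCategory.homologyFunctor _ n).obj
      ((DerivedCategory.singleFunctor _ 0).obj N)) := by
    rintro n (hn | hn)
    · exact DerivedCategory.isZero_of_isGE _ 0 n hn
    · exact DerivedCategory.isZero_of_isLE _ 0 n hn
  refine ⟨⟨0, 0, h⟩, fun n => ?_⟩
  rcases lt_trichotomy n 0 with hn | rfl | hn
  · have := ModuleCat.subsingleton_of_isZero (h n (.inl hn))
    infer_instance
  · let e : (DerivedCategory.homologyFunctor _ 0).obj ((DerivedCategory.singleFunctor _ 0).obj N) ≅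
      N := (DerivedCategory.singleFunctorCompHomologyFunctorIso _ 0).app N
    exact Module.Finite.equiv e.toLinearEquiv.symm
  · have := ModuleCat.subsingleton_of_isZero (h n (.inr hn))
    infer_instance

theorem mem_Db_of_gen [IsNoetherianRing A] {M X : DerivedCategory (ModuleCat.{0} A)}
    (hM : M ∈ Db A) (hX : gen _ M X) : X ∈ Db A := by
  induction hX with
  | base => exact hM
  | @sum X Y Z i p j q _ _ h1 h2 h3 h4 h5 hX hY =>
    refine mem_Db_of_exact hX hY fun n => ?_
    let σ : (ShortComplex.mk i q h3).Splitting := { r := p, s := j }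
    exact ⟨_, (σ.map (DerivedCategory.homologyFunctor _ n)).exact, rfl, rfl, rfl⟩
  | shift n _ ih => exact shift_mem_Db ih n
  | retract _ h ih => exact mem_Db_of_isRetract h ih

theorem level_subset_Db [IsNoetherianRing A] {M : DerivedCategory (ModuleCat.{0} A)}
    (hM : M ∈ Db A) (n : ℕ) : level _ M n ⊆ Db A := by
  induction n with
  | zero =>
    intro X hX
    have h (n : ℤ) : IsZero ((DerivedCategory.homologyFunctor _ n).obj X) :=
      Functor.map_isZero _ hX
    refine ⟨⟨0, 0, fun n _ => h n⟩, fun n => ?_⟩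
    have := ModuleCat.subsingleton_of_isZero (h n)
    infer_instance
  | succ n ih =>
    rintro X ⟨X₁, Z, X₂, f, g, h, hT, h1, h2, hX⟩
    exact mem_Db_of_isRetract hX (mem_Db_of_exact (ih h1) (mem_Db_of_gen hM h2) fun n =>
      ⟨_, DerivedCategory.HomologySequence.exact₂ _ hT n, rfl, rfl, rfl⟩)

end DbClosure

section FiniteModel

variable {A : Type} [Ring A]

/-- Finitely generated submodules of the range of `f` are images of finitely generated
submodules. -/
theorem exists_fg_map_eq {M M' : Type*} [AddCommGroup M] [Module A M] [AddCommGroup M']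
    [Module A M'] (f : M →ₗ[A] M') (T : Submodule A M') (hT : T.FG)
    (hf : T ≤ LinearMap.range f) : ∃ S : Submodule A M, S.FG ∧ S.map f = T := by
  classical
  obtain ⟨t, rfl⟩ := hT
  obtain ⟨s, -, rfl⟩ := Finset.subset_set_image_iff.1
    (show (t : Set M') ⊆ f '' Set.univ by
      rw [Set.image_univ]
      exact fun x hx => hf (Submodule.subset_span hx))
  exact ⟨Submodule.span A s, ⟨s, rfl⟩, by rw [Submodule.map_span, Finset.coe_image]⟩

theorem exists_fg_generating_shortComplex_homology (S : ShortComplex (ModuleCat.{0} A))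
    [Module.Finite A S.homology] :
    ∃ T : Submodule A S.X₂, T.FG ∧ (∀ x ∈ T, S.g x = 0) ∧
      ∀ x, S.g x = 0 → ∃ y ∈ T, ∃ z, x = y + S.f z := by
  have : Module.Finite A (LinearMap.ker S.g.hom ⧸ LinearMap.range S.moduleCatToCycles) :=
    Module.Finite.equiv S.moduleCatHomologyIso.toLinearEquiv
  obtain ⟨T, hT, h⟩ := exists_fg_map_eq
    (LinearMap.range S.moduleCatToCycles).mkQ ⊤ Module.Finite.fg_top (by simp)
  refine ⟨T.map (Submodule.subtype _), hT.map _, ?_, fun x hx => ?_⟩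
  · rintro _ ⟨x, -, rfl⟩
    exact x.2
  · obtain ⟨y, hy, hyx⟩ : Submodule.Quotient.mk ⟨x, hx⟩ ∈ T.map _ := h ▸ Submodule.mem_top
    obtain ⟨z, hz⟩ := (Submodule.Quotient.eq _).1 hyx.symm
    refine ⟨y, ⟨y, hy, rfl⟩, z, ?_⟩
    have hz' : S.f z = x - y := congr_arg Subtype.val hz
    rw [hz', add_sub_cancel]

variable (X : CochainComplex (ModuleCat.{0} A) ℤ)

theorem exists_fg_generating_homology {i j k : ℤ} (hij : i + 1 = j) (hjk : j + 1 = k)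
    [Module.Finite A (X.homology j)] :
    ∃ S : Submodule A (X.X j), S.FG ∧ (∀ x ∈ S, X.d j k x = 0) ∧
      ∀ x, X.d j k x = 0 → ∃ y ∈ S, ∃ z, x = y + X.d i j z :=
  have : Module.Finite A (X.sc' i j k).homology := Module.Finite.equiv
    (X.homologyIsoSc' i j k (by simp; lia) (by simpa)).toLinearEquiv
  exists_fg_generating_shortComplex_homology (X.sc' i j k)

/-- `Y` looks like a quasi-isomorphic subcomplex of `X` in the spot `i`. -/
def GoodAt (Y : ∀ i, Submodule A (X.X i)) (i : ℤ) : Prop :=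
  (∀ j, i + 1 = j → ∀ x ∈ Y i, X.d i j x ∈ Y j) ∧
  (∀ j, i + 1 = j → ∀ x, X.d i j x ∈ Y j → ∃ y ∈ Y i, X.d i j y = X.d i j x) ∧
  ∀ j l, i + 1 = j → l + 1 = i → ∀ x, X.d i j x = 0 → ∃ y ∈ Y i, ∃ z, x = y + X.d l i z

variable {X}

theorem goodAt_of_subsingleton (Y : ∀ i, Submodule A (X.X i)) (i : ℤ) [Subsingleton (X.X i)] :
    GoodAt X Y i :=
  ⟨fun j _ x _ => by rw [Subsingleton.elim x 0, map_zero]; exact zero_mem _,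
    fun j _ x _ => ⟨0, zero_mem _, by rw [Subsingleton.elim x 0]⟩,
    fun j l _ _ x _ => ⟨0, zero_mem _, 0, Subsingleton.elim _ _⟩⟩

theorem exists_goodAt_of_gt [IsNoetherianRing A] (b : ℤ)
    (hb : ∀ i, b < i → Subsingleton (X.X i)) (hX : ∀ i, Module.Finite A (X.homology i)) (n : ℕ) :
    ∃ Y : ∀ i, Submodule A (X.X i), (∀ i, (Y i).FG) ∧ ∀ i, b - n < i → GoodAt X Y i := by
  induction n with
  | zero =>
    refine ⟨fun _ => ⊥, fun _ => Submodule.fg_bot, fun i hi => ?_⟩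
    have := hb i (by simpa using hi)
    exact goodAt_of_subsingleton _ _
  | succ n ih =>
    obtain ⟨Y, hY, h⟩ := ih
    obtain ⟨c, rfl⟩ : ∃ c, b = c + n := ⟨b - n, by lia⟩
    have hY' : (Y (c + 1) ⊓ LinearMap.range (X.d c (c + 1)).hom).FG := by
      have := isNoetherian_submodule.1 (isNoetherian_of_fg_of_noetherian _ (hY (c + 1)))
      exact this _ inf_le_left
    obtain ⟨S₁, hS₁, h₁⟩ := exists_fg_map_eq (X.d c (c + 1)).hom _ hY' inf_le_right
    obtain ⟨S₂, hS₂, h₂, h₃⟩ := exists_fg_generating_homology X (sub_add_cancel c 1) rfl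
    refine ⟨Function.update Y c (S₁ ⊔ S₂), fun i => ?_, fun i hi => ?_⟩
    · rcases eq_or_ne i c with rfl | hic
      · rw [Function.update_self]
        exact hS₁.sup hS₂
      · rw [Function.update_of_ne hic]
        exact hY i
    · obtain rfl | hic : i = c ∨ c < i := by
        push_cast at hi
        lia
      · refine ⟨?_, ?_, ?_⟩
        · rintro j rfl x hx
          rw [Function.update_self] at hx
          rw [Function.update_of_ne (by lia)]
          obtain ⟨y, hy, z, hz, rfl⟩ := Submodule.mem_sup.1 hx
          rw [map_add, h₂ z hz, add_zero]
          exact (h₁.le ⟨y, hy, rfl⟩).1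
        · rintro j rfl x hx
          rw [Function.update_of_ne (by lia)] at hx
          rw [Function.update_self]
          obtain ⟨y, hy, hyx⟩ := h₁.ge ⟨hx, x, rfl⟩
          exact ⟨y, Submodule.mem_sup_left hy, hyx⟩
        · rintro j l rfl hl x hx
          obtain rfl : l = i - 1 := by lia
          rw [Function.update_self]
          obtain ⟨y, hy, z, hz⟩ := h₃ x hx
          exact ⟨y, Submodule.mem_sup_right hy, z, hz⟩
      · obtain ⟨g1, g2, g3⟩ := h i (by lia)
        refine ⟨?_, ?_, ?_⟩
        · rintro j rfl
          rw [Function.update_of_ne (by lia), Function.update_of_ne (by lia)]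
          exact g1 _ rfl
        · rintro j rfl
          rw [Function.update_of_ne (by lia), Function.update_of_ne (by lia)]
          exact g2 _ rfl
        · rw [Function.update_of_ne (by lia)]
          exact g3

/-- The subcomplex with components `Y i`. -/
def subcomplex (Y : ∀ i, Submodule A (X.X i)) (h : ∀ i j, ∀ x ∈ Y i, X.d i j x ∈ Y j) :
    CochainComplex (ModuleCat.{0} A) ℤ where
  X i := ModuleCat.of A (Y i)
  d i j := ModuleCat.ofHom ((X.d i j).hom.restrict (h i j))
  shape i j hij := by
    ext x
    exact congr($(X.shape i j hij) x.1)
  d_comp_d' i j k _ _ := by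
    ext x
    exact congr($(X.d_comp_d i j k) x.1)

/-- The quotient complex with components `X.X i ⧸ Y i`. -/
def quotientComplex (Y : ∀ i, Submodule A (X.X i)) (h : ∀ i j, ∀ x ∈ Y i, X.d i j x ∈ Y j) :
    CochainComplex (ModuleCat.{0} A) ℤ where
  X i := ModuleCat.of A (X.X i ⧸ Y i)
  d i j := ModuleCat.ofHom ((Y i).mapQ (Y j) (X.d i j).hom (h i j))
  shape i j hij := by
    ext x
    exact congr(Submodule.Quotient.mk ($(X.shape i j hij) x))
  d_comp_d' i j k _ _ := by
    ext x
    exact congr(Submodule.Quotient.mk ($(X.d_comp_d i j k) x))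

/-- The short exact sequence of a subcomplex. -/
def subcomplexSequence (Y : ∀ i, Submodule A (X.X i)) (h : ∀ i j, ∀ x ∈ Y i, X.d i j x ∈ Y j) :
    ShortComplex (CochainComplex (ModuleCat.{0} A) ℤ) where
  X₁ := subcomplex Y h
  X₂ := X
  X₃ := quotientComplex Y h
  f := { f := fun i => ModuleCat.ofHom (Y i).subtype }
  g := { f := fun i => ModuleCat.ofHom (Y i).mkQ }
  zero := by
    ext i x
    exact (Submodule.Quotient.mk_eq_zero _).2 x.2

theorem subcomplexSequence_shortExact (Y : ∀ i, Submodule A (X.X i))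
    (h : ∀ i j, ∀ x ∈ Y i, X.d i j x ∈ Y j) : (subcomplexSequence Y h).ShortExact := by
  apply HomologicalComplex.shortExact_of_degreewise_shortExact
  intro i
  apply ModuleCat.shortComplex_shortExact
  · exact LinearMap.exact_subtype_mkQ (Y i)
  · exact Subtype.val_injective
  · exact (Y i).mkQ_surjective

/-- An object of `D^b(mod A)` is represented by a bounded complex of finitely generated
modules. -/
theorem exists_iso_Q_obj_of_mem_Db [IsNoetherianRing A] {X : DerivedCategory (ModuleCat.{0} A)}
    (hX : X ∈ Db A) : ∃ (K : CochainComplex (ModuleCat.{0} A) ℤ) (s : Finset ℤ),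
      (∀ i ∉ s, Subsingleton (K.X i)) ∧ (∀ i, Module.Finite A (K.X i)) ∧
      Nonempty (X ≅ DerivedCategory.Q.obj K) := by
  obtain ⟨⟨a, b, h1⟩, h2⟩ := hX
  have : X.IsGE a := (X.isGE_iff a).2 fun i hi => h1 i (.inl hi)
  have : X.IsLE b := (X.isLE_iff b).2 fun i hi => h1 i (.inr hi)
  obtain ⟨K, _, _, ⟨e⟩⟩ := DerivedCategory.exists_iso_Q_obj_of_isGE_of_isLE X a b
  have ha : ∀ i, i < a → Subsingleton (K.X i) := fun i hi =>
    ModuleCat.subsingleton_of_isZero (K.isZero_of_isStrictlyGE a i)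
  have hb : ∀ i, b < i → Subsingleton (K.X i) := fun i hi =>
    ModuleCat.subsingleton_of_isZero (K.isZero_of_isStrictlyLE b i)
  have hK : ∀ i, Module.Finite A (K.homology i) := fun i => by
    have := h2 i
    let e' : (DerivedCategory.homologyFunctor _ i).obj X ≅ K.homology i :=
      (DerivedCategory.homologyFunctor _ i).mapIso e ≪≫
        (DerivedCategory.homologyFunctorFactors _ i).app K
    exact Module.Finite.equiv e'.toLinearEquiv
  obtain ⟨Y, hY, hn⟩ := exists_goodAt_of_gt b hb hK (b - a + 1).toNat
  have h : ∀ i, GoodAt K Y i := by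
    intro i
    by_cases hi : i < a
    · have := ha i hi
      exact goodAt_of_subsingleton _ _
    · exact hn i (by lia)
  have hd : ∀ i j, ∀ x ∈ Y i, K.d i j x ∈ Y j := by
    intro i j x hx
    by_cases hij : i + 1 = j
    · exact (h i).1 j hij x hx
    · rw [K.shape i j hij]
      exact zero_mem _
  have hac : (quotientComplex Y hd).Acyclic := by
    intro j
    rw [exactAt_iff_apply _ (sub_add_cancel j 1) rfl]
    intro x hx
    obtain ⟨x, rfl⟩ := Submodule.Quotient.mk_surjective _ x
    have hx' : K.d j (j + 1) x ∈ Y (j + 1) := (Submodule.Quotient.mk_eq_zero _).1 hx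
    obtain ⟨y, hy, hyx⟩ := (h j).2.1 _ rfl x hx'
    obtain ⟨y', hy', z, hz⟩ := (h j).2.2 _ (j - 1) rfl (by lia) (x - y)
      (by rw [map_sub, hyx, sub_self])
    refine ⟨Submodule.Quotient.mk z, (Submodule.Quotient.eq (Y j)).2 ?_⟩
    have : K.d (j - 1) j z - x = -(y + y') := by
      rw [eq_add_of_sub_eq hz]
      abel
    exact this ▸ neg_mem (add_mem hy hy')
  have hiso := (Triangle.isZero₃_iff_isIso₁ _ (DerivedCategory.triangleOfSES_distinguished
    (subcomplexSequence_shortExact Y hd))).1 (isZero_Q_obj_of_acyclic hac)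
  refine ⟨subcomplex Y hd, Finset.Icc a b, fun i hi => ?_, fun i => ?_,
    ⟨e ≪≫ (@asIso _ _ _ _ _ hiso).symm⟩⟩
  · have : Subsingleton (K.X i) := by
      rw [Finset.mem_Icc, not_and_or, not_le, not_le] at hi
      exact hi.elim (ha i) (hb i)
    change Subsingleton (Y i)
    infer_instance
  · exact Module.Finite.iff_fg.2 (hY i)

end FiniteModel

section Cogenerator

open Module

variable {k : Type} [Field k] {A : Type} [Ring A] [Algebra k A]

theorem exists_functional_of_notMem {V : Type} [AddCommGroup V] [Module A V]
    (U : Submodule A V) {x : V} (hx : x ∉ U) :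
    ∃ f : V →ₗ[A] (A →ₗ[k] k), (∀ u ∈ U, f u = 0) ∧ f x ≠ 0 := by
  let := Module.compHom V (algebraMap k A)
  have : IsScalarTower k A V := ⟨fun c a v => by
    rw [Algebra.smul_def, mul_smul]
    rfl⟩
  obtain ⟨l, hl, hU⟩ := Submodule.exists_le_ker_of_notMem (p := U.restrictScalars k) (v := x) hx
  refine ⟨{ toFun := fun v => l ∘ₗ (LinearMap.toSpanSingleton A V v).restrictScalars k
            map_add' := fun v w => by ext a; simp
            map_smul' := fun b v => by ext a; simp [dualSMul_apply, mul_smul] }, ?_, ?_⟩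
  · intro u hu
    ext a
    exact hU (U.smul_mem a hu)
  · intro h
    apply hl
    simpa using LinearMap.congr_fun h 1

theorem acyclic_of_dualCohomology (N : Type) [AddCommGroup N] [Module A N]
    (ι : (A →ₗ[k] k) →ₗ[A] N) (hι : Function.Injective ι)
    (X : CochainComplex (ModuleCat.{0} A) ℤ) (hX : ∀ i, Subsingleton (dualCohomology N X i)) :
    X.Acyclic := by
  intro i
  rw [exactAt_iff_apply X (sub_add_cancel i 1) rfl]
  intro x hx
  by_contra! h
  obtain ⟨f, hf, hfx⟩ := exists_functional_of_notMem (k := k)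
    (LinearMap.range (X.d (i - 1) i).hom) (x := x) (fun ⟨y, hy⟩ => h y hy)
  have hfc : ι ∘ₗ f ∈ dualCycles N X i := (mem_dualCycles (sub_add_cancel i 1)).2 fun y => by
    rw [LinearMap.comp_apply, hf _ ⟨y, rfl⟩, map_zero]
  have h0 : (Submodule.Quotient.mk ⟨ι ∘ₗ f, hfc⟩ : dualCohomology N X i) = 0 :=
    Subsingleton.elim _ _
  rw [Submodule.Quotient.mk_eq_zero] at h0
  obtain ⟨g, hg⟩ := (mem_dualBoundaries rfl).1 (show ι ∘ₗ f ∈ dualBoundaries N X i from h0)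
  have := hg x
  rw [hx, map_zero, LinearMap.comp_apply, eq_comm, map_eq_zero_iff _ hι] at this
  exact hfx this

end Cogenerator

section Finiteness

open Module

variable (k : Type) [Field k] {A : Type} [Ring A] [Algebra k A]

/-- `Hom_A(X, N)` is finitely generated over `End_A(N)` and `End_A(N)` is noetherian when
everything is finite dimensional. -/
theorem finite_hom_and_isNoetherianRing_end [FiniteDimensional k A] (N : Type) [AddCommGroup N]
    [Module A N] [Module.Finite A N] : IsNoetherianRing (End A N) ∧
    ∀ (X : Type) [AddCommGroup X] [Module A X] [Module.Finite A X],
      Module.Finite (End A N) (X →ₗ[A] N) := by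
  let := Module.compHom N (algebraMap k A)
  have : IsScalarTower k A N := ⟨fun c a v => by
    rw [Algebra.smul_def, mul_smul]
    rfl⟩
  have : Module.Finite k N := Module.Finite.trans A N
  have key : ∀ (X : Type) [AddCommGroup X] [Module A X] [Module.Finite A X],
      Module.Finite k (X →ₗ[A] N) := by
    intro X _ _ _
    let := Module.compHom X (algebraMap k A)
    have : IsScalarTower k A X := ⟨fun c a v => by
      rw [Algebra.smul_def, mul_smul]
      rfl⟩
    have : Module.Finite k X := Module.Finite.trans A X
    exact Module.Finite.of_injective (LinearMap.restrictScalarsₗ k A X N k)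
      (LinearMap.restrictScalars_injective k)
  have := key N
  exact ⟨isNoetherian_of_tower k inferInstance, fun X _ _ _ =>
    have := key X
    Module.Finite.of_restrictScalars_finite k _ _⟩

end Finiteness

section Main

variable (k : Type) [Field k] {A : Type} [Ring A] [Algebra k A] [FiniteDimensional k A]

/-- If `N` contains the dual of `A`, then `D^b(mod A)` has dimension at most
`gldim End_A(N)`. -/
theorem dimLE_Db_of_gldimLE (N : Type) [AddCommGroup N] [Module A N] [Module.Finite A N]
    (ι : (A →ₗ[k] k) →ₗ[A] N) (hι : Function.Injective ι) {d : ℕ}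
    (hd : gldimLE (Module.End A N) d) : dimLE _ (Db A) d := by
  have : IsNoetherianRing A := isNoetherian_of_tower k inferInstance
  obtain ⟨_, hN⟩ := finite_hom_and_isNoetherianRing_end k (A := A) N
  have hM := single_mem_Db (ModuleCat.of A N)
  refine ⟨_, hM, (level_subset_Db hM _).antisymm fun X hX => ?_⟩
  obtain ⟨K, s, hs, hK, ⟨e⟩⟩ := exists_iso_Q_obj_of_mem_Db hX
  exact level_of_iso e (mem_level_of_dualCohomology N hN (acyclic_of_dualCohomology N ι hι) _ K s
    hs hK fun i => hasProjectiveDimensionLT_of_pdLE d _ (hd _ _ _))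

theorem trdim_Db_le_gldim (N : Type) [AddCommGroup N] [Module A N] [Module.Finite A N]
    (ι : (A →ₗ[k] k) →ₗ[A] N) (hι : Function.Injective ι) :
    trdim _ (Db A) ≤ gldim (Module.End A N) := by
  refine le_sInf ?_
  rintro _ ⟨d, hd, rfl⟩
  exact sInf_le ⟨d, dimLE_Db_of_gldimLE k N ι hι hd, rfl⟩

theorem finite_dual : Module.Finite A (A →ₗ[k] k) := by
  have : IsScalarTower k A (A →ₗ[k] k) := ⟨fun c a f => by
    ext x
    simp [dualSMul_apply]⟩
  exact Module.Finite.of_restrictScalars_finite k A _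

end Main

/-- **Rouquier**: for a finite dimensional algebra `A` over a field `k`, the dimension of
the bounded derived category `D^b(mod A)` is at most the representation dimension
of `A`. -/
theorem dim_Db_le_repdim (k : Type) [Field k]
    (A : Type) [Ring A] [Algebra k A] [FiniteDimensional k A] :
    trdim _ (Db A) ≤ repdim k A := by
  refine le_sInf ?_
  rintro _ ⟨M, _, _, _, rfl⟩
  have := finite_dual k (A := A)
  exact trdim_Db_le_gldim k (A × (A →ₗ[k] k) × M)
    (LinearMap.inr A A _ ∘ₗ LinearMap.inl A _ M)
    (LinearMap.inr_injective.comp LinearMap.inl_injective)
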